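/- (The generator P₍₁₎ of the generalized Lie symmetry of S₁ lies in the kernel of the Lagrangian two-form.) Let m > 0, q ∈ ℝ^D with q ≠ 0, v ∈ ℝ^D, and set M₁(q,v) := (m/‖q‖²) Π(q) and F₁(q,v) w := (m/‖q‖³) ( ((Π(q)v)·w) q̂ − (q̂·w) Π(q)v ). Then M₁(q,v) q̂ = 0 and M₁(q,v) (v/‖q‖) = −F₁(q,v) q̂. Consequently the pair (q̂, v/‖q‖), i.e. the vector field P₍₁₎ = q̂·∂/∂q + (v/‖q‖)·∂/∂v, lies in the kernel of the bilinear form Ω((x,u),(y,w)) = x·(F₁ y) + x·(M₁ w) − y·(M₁ u). -/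

import Mathlib

open scoped RealInnerProductSpace

/-- The unit vector `q̂ = q/‖q‖`. -/
noncomputable def nhat {D : ℕ} (q : EuclideanSpace ℝ (Fin D)) : EuclideanSpace ℝ (Fin D) :=
  ‖q‖⁻¹ • q

/-- The orthogonal projection `Π(q)w = w − (q̂·w) q̂` onto the hyperplane orthogonal to `q`. -/
noncomputable def proj {D : ℕ} (q w : EuclideanSpace ℝ (Fin D)) : EuclideanSpace ℝ (Fin D) :=
  w - ⟪nhat q, w⟫ • nhat q

/-- The velocity Hessian of `L₁` as an operator: `M₁(q) u = (m/‖q‖²) Π(q) u`. -/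
noncomputable def M1op {D : ℕ} (m : ℝ)
    (q u : EuclideanSpace ℝ (Fin D)) : EuclideanSpace ℝ (Fin D) :=
  (m / ‖q‖ ^ 2) • proj q u

/-- The antisymmetric operator `F₁(q,v) w = (m/‖q‖³)( ((Π(q)v)·w) q̂ − (q̂·w) Π(q)v )`. -/
noncomputable def F1op {D : ℕ} (m : ℝ)
    (q v w : EuclideanSpace ℝ (Fin D)) : EuclideanSpace ℝ (Fin D) :=
  (m / ‖q‖ ^ 3) • (⟪proj q v, w⟫ • nhat q - ⟪nhat q, w⟫ • proj q v)

section

variable {D : ℕ} {q : EuclideanSpace ℝ (Fin D)}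

theorem inner_nhat_self (hq : q ≠ 0) : ⟪nhat q, nhat q⟫ = 1 := by
  have h : ‖q‖ ≠ 0 := norm_ne_zero_iff.mpr hq
  rw [nhat, real_inner_smul_left, real_inner_smul_right, real_inner_self_eq_norm_sq]
  field_simp

theorem proj_nhat (hq : q ≠ 0) : proj q (nhat q) = 0 := by
  rw [proj, inner_nhat_self hq, one_smul, sub_self]

theorem inner_nhat_proj (hq : q ≠ 0) (w : EuclideanSpace ℝ (Fin D)) :
    ⟪nhat q, proj q w⟫ = 0 := by
  rw [proj, inner_sub_right, real_inner_smul_right, inner_nhat_self hq, mul_one, sub_self]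

theorem proj_smul (c : ℝ) (w : EuclideanSpace ℝ (Fin D)) :
    proj q (c • w) = c • proj q w := by
  rw [proj, proj, real_inner_smul_right, mul_smul, smul_sub]

theorem M1op_inv_norm_smul (m : ℝ) (v : EuclideanSpace ℝ (Fin D)) :
    M1op m q (‖q‖⁻¹ • v) = (m / ‖q‖ ^ 3) • proj q v := by
  rw [M1op, proj_smul, smul_smul, ← div_eq_mul_inv, div_div, ← pow_succ]

end

/-- `M₁ q̂ = 0` and `M₁ (v/‖q‖) = −F₁ q̂`; consequently the pair
`P₍₁₎ = (q̂, v/‖q‖)` lies in the kernel of the Lagrangian two-form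
`Ω((x,u),(y,w)) = x·(F₁ y) + x·(M₁ w) − y·(M₁ u)`. -/
theorem statement11 (D : ℕ) (hD : 1 ≤ D) (m : ℝ) (hm : 0 < m)
    (q v : EuclideanSpace ℝ (Fin D)) (hq : q ≠ 0) :
    M1op m q (nhat q) = 0 ∧
    M1op m q (‖q‖⁻¹ • v) = -F1op m q v (nhat q) ∧
    ∀ y w : EuclideanSpace ℝ (Fin D),
      ⟪nhat q, F1op m q v y⟫ + ⟪nhat q, M1op m q w⟫ - ⟪y, M1op m q (‖q‖⁻¹ • v)⟫ = 0 := by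
  refine ⟨by rw [M1op, proj_nhat hq, smul_zero], ?_, fun y w => ?_⟩
  · rw [M1op_inv_norm_smul, F1op, real_inner_comm, inner_nhat_proj hq, inner_nhat_self hq,
      zero_smul, one_smul, zero_sub, smul_neg, neg_neg]
  · rw [M1op_inv_norm_smul, F1op, M1op]
    simp only [real_inner_smul_right, inner_sub_right, inner_nhat_proj hq, inner_nhat_self hq]
    rw [real_inner_comm y (proj q v)]
    ring
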